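/- arXiv:1310.7504 — 5 statements merged into one kernel-verified Lean document; each statement's English description precedes it below -/
import Mathlib

section
/- Let {S_ℓ}_{ℓ≥1} be a positive nondecreasing sequence of real numbers, let {b_ℓ}_{ℓ≥1} and {k_ℓ}_{ℓ≥1} be nonnegative sequences of real numbers, and let p>1 be a real constant. Define a_ℓ := ∏_{s=1}^{ℓ-1} 1/(1+b_s) for ℓ≥2 (and a_1 := 1). Suppose that S_{ℓ+1} − S_ℓ ≤ b_ℓ S_ℓ + k_ℓ S_ℓ^p for all ℓ≥1, and that S_1^{1−p} + (1−p) ∑_{s=1}^{ℓ−1} k_s a_{s+1}^{1−p} > 0 for all ℓ≥2. Then for every ℓ≥2 one has S_ℓ ≤ (1/a_ℓ) · { S_1^{1−p} + (1−p) ∑_{s=1}^{ℓ−1} k_s a_{s+1}^{1−p} }^{1/(1−p)}. -/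
open Finset

/-- Bernoulli's inequality for a nonpositive real exponent. -/
theorem one_add_mul_sub_one_le_rpow_of_nonpos {t q : ℝ} (ht : 0 < t) (hq : q ≤ 0) :
    1 + q * (t - 1) ≤ t ^ q := by
  rw [Real.rpow_def_of_pos ht]
  have h_log := mul_le_mul_of_nonpos_left (Real.log_le_sub_one_of_pos ht) hq
  linarith [Real.add_one_le_exp (Real.log t * q)]

/-- The function `x ↦ x ^ (1 - p)` turns a Bernoulli-type difference inequality into a linear one. -/
theorem rpow_one_sub_add_le_of_le_add_mul_rpow {y z c p : ℝ} (hp : 1 ≤ p) (hy : 0 < y)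
    (hz : 0 < z) (h : z ≤ y + c * y ^ p) :
    y ^ (1 - p) + (1 - p) * c ≤ z ^ (1 - p) := by
  have hq : 1 - p ≤ 0 := by linarith
  have h_ratio : z / y - 1 ≤ c * y ^ (p - 1) := by
    rw [Real.rpow_sub_one hy.ne', div_sub_one hy.ne', ← mul_div_assoc]
    gcongr
    linarith
  have h_cancel : y ^ (p - 1) * y ^ (1 - p) = 1 := by
    rw [← Real.rpow_add hy]
    simp
  have hypos : 0 < y ^ (1 - p) := Real.rpow_pos_of_pos hy _
  calc y ^ (1 - p) + (1 - p) * c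
      = (1 + (1 - p) * (c * y ^ (p - 1))) * y ^ (1 - p) := by
        linear_combination (-(1 - p) * c) * h_cancel
    _ ≤ (z / y) ^ (1 - p) * y ^ (1 - p) := by
        gcongr
        linarith [mul_le_mul_of_nonpos_left h_ratio hq,
          one_add_mul_sub_one_le_rpow_of_nonpos (div_pos hz hy) hq]
    _ = z ^ (1 - p) := by
        rw [← Real.mul_rpow (div_pos hz hy).le hy.le, div_mul_cancel₀ _ hy.ne']

/-- Nonlinear (Bernoulli-type) discrete Gronwall inequality. -/
theorem discrete_nonlinear_gronwall
    (S b k : ℕ → ℝ) (p : ℝ) (hp : 1 < p)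
    (hSpos : ∀ ℓ, 1 ≤ ℓ → 0 < S ℓ)
    (hSmono : ∀ ℓ, 1 ≤ ℓ → S ℓ ≤ S (ℓ + 1))
    (hb : ∀ ℓ, 1 ≤ ℓ → 0 ≤ b ℓ)
    (hk : ∀ ℓ, 1 ≤ ℓ → 0 ≤ k ℓ)
    (a : ℕ → ℝ)
    (ha : ∀ ℓ, 2 ≤ ℓ → a ℓ = ∏ s ∈ Finset.Icc 1 (ℓ - 1), 1 / (1 + b s))
    (ha1 : a 1 = 1)
    (hrec : ∀ ℓ, 1 ≤ ℓ → S (ℓ + 1) - S ℓ ≤ b ℓ * S ℓ + k ℓ * S ℓ ^ p)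
    (hpos : ∀ ℓ, 2 ≤ ℓ →
      0 < S 1 ^ (1 - p) + (1 - p) * ∑ s ∈ Finset.Icc 1 (ℓ - 1), k s * a (s + 1) ^ (1 - p)) :
    ∀ ℓ, 2 ≤ ℓ →
      S ℓ ≤ (1 / a ℓ) *
        (S 1 ^ (1 - p) + (1 - p) * ∑ s ∈ Finset.Icc 1 (ℓ - 1), k s * a (s + 1) ^ (1 - p))
          ^ (1 / (1 - p)) := by
  have ha_prod : ∀ ℓ, 1 ≤ ℓ → a ℓ = ∏ s ∈ Finset.Icc 1 (ℓ - 1), 1 / (1 + b s) := by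
    intro ℓ hℓ
    rcases hℓ.eq_or_lt with rfl | h
    · simp [ha1]
    · exact ha ℓ h
  have ha_pos : ∀ ℓ, 1 ≤ ℓ → 0 < a ℓ := by
    intro ℓ hℓ
    rw [ha_prod ℓ hℓ]
    refine Finset.prod_pos fun s hs => ?_
    have := hb s (Finset.mem_Icc.mp hs).1
    positivity
  have ha_succ : ∀ ℓ, 1 ≤ ℓ → a ℓ = a (ℓ + 1) * (1 + b ℓ) := by
    intro ℓ hℓ
    obtain ⟨m, rfl⟩ := Nat.exists_eq_add_of_le' hℓ
    have := hb (m + 1) hℓ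
    rw [ha_prod _ hℓ, ha_prod _ (by lia), Nat.add_sub_cancel, Nat.add_sub_cancel,
      Finset.prod_Icc_succ_top (by lia)]
    field_simp
  have h_step : ∀ ℓ, 1 ≤ ℓ →
      (a ℓ * S ℓ) ^ (1 - p) + (1 - p) * (k ℓ * a (ℓ + 1) ^ (1 - p)) ≤
        (a (ℓ + 1) * S (ℓ + 1)) ^ (1 - p) := by
    intro ℓ hℓ
    have hα := ha_pos (ℓ + 1) (by lia)
    have hS := hSpos ℓ hℓ
    have hkℓ := hk ℓ hℓ
    refine rpow_one_sub_add_le_of_le_add_mul_rpow hp.le (mul_pos (ha_pos ℓ hℓ) hS)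
      (mul_pos hα (hSpos (ℓ + 1) (by lia))) ?_
    have h_anti : a (ℓ + 1) ≤ a ℓ := by
      rw [ha_succ ℓ hℓ]
      exact le_mul_of_one_le_right hα.le (by linarith [hb ℓ hℓ])
    calc a (ℓ + 1) * S (ℓ + 1)
        ≤ a (ℓ + 1) * ((1 + b ℓ) * S ℓ + k ℓ * S ℓ ^ p) := by
          gcongr
          linarith [hrec ℓ hℓ]
      _ = a ℓ * S ℓ + k ℓ * (a (ℓ + 1) ^ (1 - p) * (a (ℓ + 1) * S ℓ) ^ p) := by
          have h_cancel : a (ℓ + 1) ^ (1 - p) * a (ℓ + 1) ^ p = a (ℓ + 1) := by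
            rw [← Real.rpow_add hα]
            simp
          rw [Real.mul_rpow hα.le hS.le, ha_succ ℓ hℓ]
          linear_combination (-k ℓ * S ℓ ^ p) * h_cancel
      _ ≤ a ℓ * S ℓ + k ℓ * (a (ℓ + 1) ^ (1 - p) * (a ℓ * S ℓ) ^ p) := by
          gcongr
      _ = a ℓ * S ℓ + k ℓ * a (ℓ + 1) ^ (1 - p) * (a ℓ * S ℓ) ^ p := by ring
  have h_sum : ∀ m,
      S 1 ^ (1 - p) + (1 - p) * ∑ s ∈ Finset.Icc 1 m, k s * a (s + 1) ^ (1 - p) ≤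
        (a (m + 1) * S (m + 1)) ^ (1 - p) := by
    intro m
    induction m with
    | zero => simp [ha1]
    | succ m ih =>
      rw [Finset.sum_Icc_succ_top (by lia), mul_add]
      linarith [h_step (m + 1) (by lia)]
  intro ℓ hℓ
  have haℓ := ha_pos ℓ (by lia)
  have hyℓ : 0 < a ℓ * S ℓ := mul_pos haℓ (hSpos ℓ (by lia))
  have h_bound := h_sum (ℓ - 1)
  rw [Nat.sub_add_cancel (by lia)] at h_bound
  have h_root := Real.rpow_le_rpow_of_nonpos (hpos ℓ hℓ) h_bound
    (one_div_nonpos.mpr (by linarith : 1 - p ≤ 0))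
  rw [← Real.rpow_mul hyℓ.le, mul_one_div_cancel (by linarith : 1 - p < 0).ne,
    Real.rpow_one] at h_root
  rw [one_div_mul_eq_div, le_div_iff₀' haℓ]
  exact h_root
end

section
/- Let {S_ℓ}_{ℓ≥1} be a positive nondecreasing sequence of real numbers, let β, κ ≥ 0 be real constants, and let p>1 be a real constant. Define a_ℓ := (1+β)^{−(ℓ−1)} for ℓ≥1. Suppose that S_{ℓ+1} − S_ℓ ≤ β S_ℓ + κ S_ℓ^p for all ℓ≥1. If for some integer L≥2 one has (1/2) S_1^{1−p} − (p−1) κ ∑_{s=1}^{L−1} a_{s+1}^{1−p} ≥ 0, then S_L ≤ 2^{1/(p−1)} (1/a_L) S_1. -/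
open Finset

/-- Bernoulli's inequality for a negative real exponent. -/
lemma one_sub_mul_le_rpow_neg {x q : ℝ} (hx : 0 < x) (hq : 0 ≤ q) :
    1 - q * (x - 1) ≤ x ^ (-q) := by
  rw [Real.rpow_def_of_pos hx]
  have h₁ := Real.add_one_le_exp (Real.log x * -q)
  have h₂ := mul_le_mul_of_nonneg_left (Real.log_le_sub_one_of_pos hx) hq
  linarith

/-- One step of a Bernoulli-type difference inequality, linearized by `x ↦ x ^ (1 - p)`. -/
lemma rpow_one_sub_sub_le {x y p c : ℝ} (hx : 0 < x) (hy : 0 < y) (hp : 1 < p)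
    (h : y ≤ x + c * x ^ p) : x ^ (1 - p) - (p - 1) * c ≤ y ^ (1 - p) := by
  have hb := one_sub_mul_le_rpow_neg (div_pos hy hx) (sub_nonneg.2 hp.le)
  rw [neg_sub, Real.div_rpow hy.le hx.le, le_div_iff₀ (Real.rpow_pos_of_pos hx _)] at hb
  refine le_trans ?_ hb
  have hdiv : y / x - 1 ≤ c * x ^ (p - 1) := by
    rw [Real.rpow_sub_one hx.ne', sub_le_iff_le_add, div_le_iff₀ hx]
    field_simp
    linarith
  have hmul : x ^ (p - 1) * x ^ (1 - p) = 1 := by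
    rw [← Real.rpow_add hx]; simp
  calc x ^ (1 - p) - (p - 1) * c
      = (1 - (p - 1) * (c * x ^ (p - 1))) * x ^ (1 - p) := by
        linear_combination (p - 1) * c * hmul
    _ ≤ (1 - (p - 1) * (y / x - 1)) * x ^ (1 - p) := by
        have := sub_nonneg.2 hp.le
        gcongr

/-- A lower bound on a negative power by half of another gives an upper bound on the base. -/
lemma le_two_rpow_mul_of_half_rpow_le {x y p : ℝ} (hx : 0 < x) (hy : 0 < y) (hp : 1 < p)
    (h : 1 / 2 * x ^ (1 - p) ≤ y ^ (1 - p)) : y ≤ 2 ^ (1 / (p - 1)) * x := by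
  have hp' : p - 1 ≠ 0 := (sub_pos.2 hp).ne'
  have h₂ : ((2 : ℝ) ^ (1 / (p - 1))) ^ (1 - p) = 1 / 2 := by
    rw [← Real.rpow_mul zero_le_two, show 1 / (p - 1) * (1 - p) = -1 by field_simp; ring,
      Real.rpow_neg_one, one_div]
  rw [← h₂, ← Real.mul_rpow (by positivity) hx.le] at h
  exact (Real.rpow_le_rpow_iff_of_neg (by positivity) hy (sub_neg.2 hp)).1 h

/-- Constant-coefficient Bernoulli-type discrete Gronwall inequality with the
explicit doubling bound. -/
theorem discrete_gronwall_doubling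
    (S : ℕ → ℝ) (β κ p : ℝ) (hβ : 0 ≤ β) (hκ : 0 ≤ κ) (hp : 1 < p)
    (hSpos : ∀ ℓ, 1 ≤ ℓ → 0 < S ℓ)
    (hSmono : ∀ ℓ, 1 ≤ ℓ → S ℓ ≤ S (ℓ + 1))
    (a : ℕ → ℝ)
    (ha : ∀ ℓ, 1 ≤ ℓ → a ℓ = (1 + β) ^ (-((ℓ : ℝ) - 1)))
    (hrec : ∀ ℓ, 1 ≤ ℓ → S (ℓ + 1) - S ℓ ≤ β * S ℓ + κ * S ℓ ^ p)
    (L : ℕ) (hL : 2 ≤ L)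
    (hsmall : 0 ≤ (1 / 2) * S 1 ^ (1 - p)
        - (p - 1) * κ * ∑ s ∈ Finset.Icc 1 (L - 1), a (s + 1) ^ (1 - p)) :
    S L ≤ 2 ^ (1 / (p - 1)) * (1 / a L) * S 1 := by
  have hβ1 : 0 < 1 + β := by positivity
  have hapos : ∀ ℓ, 1 ≤ ℓ → 0 < a ℓ := fun ℓ hℓ => by
    rw [ha ℓ hℓ]; positivity
  have hsucc : ∀ ℓ, 1 ≤ ℓ → a (ℓ + 1) * (1 + β) = a ℓ := fun ℓ hℓ => by
    rw [ha ℓ hℓ, ha (ℓ + 1) (by omega), ← Real.rpow_add_one hβ1.ne']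
    congr 1; push_cast; ring
  have hle : ∀ ℓ, 1 ≤ ℓ → a (ℓ + 1) ≤ a ℓ := fun ℓ hℓ => by
    nlinarith [hsucc ℓ hℓ, hapos (ℓ + 1) (by omega)]
  have hstep : ∀ ℓ, 1 ≤ ℓ → a (ℓ + 1) * S (ℓ + 1) ≤
      a ℓ * S ℓ + κ * a (ℓ + 1) ^ (1 - p) * (a ℓ * S ℓ) ^ p := fun ℓ hℓ => by
    have h1 := hapos (ℓ + 1) (by omega)
    have hS := hSpos ℓ hℓ
    have hcoef : a (ℓ + 1) ≤ a (ℓ + 1) ^ (1 - p) * a ℓ ^ p := by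
      calc a (ℓ + 1) = a (ℓ + 1) ^ (1 - p) * a (ℓ + 1) ^ p := by
            rw [← Real.rpow_add h1]; simp
        _ ≤ _ := by gcongr; exact hle ℓ hℓ
    have hSp : 0 ≤ κ * S ℓ ^ p := by positivity
    rw [Real.mul_rpow (hapos ℓ hℓ).le hS.le]
    calc a (ℓ + 1) * S (ℓ + 1) ≤ a (ℓ + 1) * ((1 + β) * S ℓ + κ * S ℓ ^ p) := by
          gcongr; linarith [hrec ℓ hℓ]
      _ = a ℓ * S ℓ + a (ℓ + 1) * (κ * S ℓ ^ p) := by rw [← hsucc ℓ hℓ]; ring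
      _ ≤ a ℓ * S ℓ + a (ℓ + 1) ^ (1 - p) * a ℓ ^ p * (κ * S ℓ ^ p) := by gcongr
      _ = _ := by ring
  have ha1 : a 1 = 1 := by rw [ha 1 le_rfl]; simp
  have hsum : ∀ n : ℕ, S 1 ^ (1 - p) - (p - 1) * κ * ∑ s ∈ Finset.Icc 1 n, a (s + 1) ^ (1 - p)
      ≤ (a (n + 1) * S (n + 1)) ^ (1 - p) := by
    intro n
    induction n with
    | zero => simp [ha1]
    | succ n ih =>
      rw [Finset.sum_Icc_succ_top (by omega)]
      have := rpow_one_sub_sub_le (mul_pos (hapos (n + 1) (by omega)) (hSpos (n + 1) (by omega)))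
        (mul_pos (hapos (n + 1 + 1) (by omega)) (hSpos (n + 1 + 1) (by omega))) hp
        (hstep (n + 1) (by omega))
      linarith
  have hfin := hsum (L - 1)
  rw [Nat.sub_add_cancel (by omega)] at hfin
  have haL := hapos L (by omega)
  have := le_two_rpow_mul_of_half_rpow_le (hSpos 1 le_rfl) (mul_pos haL (hSpos L (by omega))) hp
    (by linarith)
  rw [mul_one_div, div_mul_eq_mul_div, le_div_iff₀ haL]
  linarith
end

section
/- For all real numbers a and b, (a³ − b)(a − b) ≥ (1/4)[(a² − 1)² − (b² − 1)²] + (1/4)(a² − b²)² + (1/2)(a − b)². -/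
/-- Pointwise inequality behind the unconditional discrete energy law for the
convex-splitting treatment `f^{m+1} = (u^{m+1})³ − u^m`. -/
theorem convex_splitting_pointwise_ineq (a b : ℝ) :
    (a ^ 3 - b) * (a - b) ≥
      (1 / 4) * ((a ^ 2 - 1) ^ 2 - (b ^ 2 - 1) ^ 2)
        + (1 / 4) * (a ^ 2 - b ^ 2) ^ 2 + (1 / 2) * (a - b) ^ 2 := by
  linarith [sq_nonneg (a * (a - b))]
end

section
/- For all real numbers a and b, (a³ − a)(a − b) ≥ (1/4)[(a² − 1)² − (b² − 1)²] + (1/4)(a² − b²)² − (1/2)(a − b)². -/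
/-- Pointwise inequality behind the conditional discrete energy law for the
fully implicit treatment `f^{m+1} = (u^{m+1})³ − u^{m+1}`. -/
theorem fully_implicit_pointwise_ineq (a b : ℝ) :
    (a ^ 3 - a) * (a - b) ≥
      (1 / 4) * ((a ^ 2 - 1) ^ 2 - (b ^ 2 - 1) ^ 2)
        + (1 / 4) * (a ^ 2 - b ^ 2) ^ 2 - (1 / 2) * (a - b) ^ 2 := by
  nlinarith [sq_nonneg (a * (a - b))]
end

section
/- Let (Ω, μ) be a measure space with μ(Ω) < ∞, let V be a finite-dimensional linear subspace of L⁴(μ; ℝ), let a : V × V → ℝ be a symmetric bilinear form with a(v,v) ≥ 0 for all v ∈ V, let w ∈ V, and let k, ε > 0. Define H : V → ℝ by H(v) := (k/2) a(v,v) + (k/ε²) ∫_Ω (1/4)(v⁴ + 1) dμ + (1/2) ∫_Ω v² dμ − (k/ε² + 1) ∫_Ω w v dμ. Then H has a unique minimizer over V. -/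
open MeasureTheory

/-- A coercive, strictly convex functional on a finite-dimensional space, made of nonnegative
quadratic terms, the fourth power of the norm and a linear term, has a unique minimizer. -/
theorem existsUnique_minimizer_quadratic_add_norm_pow_four
    {E : Type*} [NormedAddCommGroup E] [NormedSpace ℝ E] [FiniteDimensional ℝ E]
    (a b : E →ₗ[ℝ] E →ₗ[ℝ] ℝ) (ha : ∀ v, 0 ≤ a v v) (hb : ∀ v, v ≠ 0 → 0 < b v v)
    (l : E →ₗ[ℝ] ℝ) {c : ℝ} (hc : 0 < c) :
    ∃! v₀ : E, ∀ v : E,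
      a v₀ v₀ + c * ‖v₀‖ ^ 4 + b v₀ v₀ - l v₀ ≤ a v v + c * ‖v‖ ^ 4 + b v v - l v := by
  have hb' : ∀ v, 0 ≤ b v v := fun v => by
    rcases eq_or_ne v 0 with rfl | h
    · simp
    · exact (hb v h).le
  have hquad : ∀ B : E →ₗ[ℝ] E →ₗ[ℝ] ℝ, Continuous fun v => B v v := fun B =>
    ((LinearMap.toContinuousLinearMap.toLinearMap ∘ₗ B :
      E →ₗ[ℝ] E →L[ℝ] ℝ).continuous_of_finiteDimensional).clm_apply continuous_id
  have hl : Continuous l := l.continuous_of_finiteDimensional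
  have hcont : Continuous fun v => a v v + c * ‖v‖ ^ 4 + b v v - l v :=
    (((hquad a).add (by fun_prop)).add (hquad b)).sub hl
  have hcoercive : Filter.Tendsto (fun v => a v v + c * ‖v‖ ^ 4 + b v v - l v)
      (Filter.cocompact E) Filter.atTop := by
    set M := ‖l.toContinuousLinearMap‖
    have hgrowth : Filter.Tendsto (fun t : ℝ => t * (c * t ^ 3 - M)) Filter.atTop Filter.atTop :=
      Filter.tendsto_id.atTop_mul_atTop₀ <| Filter.tendsto_atTop_add_const_right _ _ <|
        (Filter.tendsto_pow_atTop (by norm_num)).const_mul_atTop hc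
    refine Filter.tendsto_atTop_mono (fun v => ?_) (hgrowth.comp tendsto_norm_cocompact_atTop)
    have h : l v ≤ M * ‖v‖ :=
      (le_abs_self _).trans (l.toContinuousLinearMap.le_opNorm v)
    simp only [Function.comp_apply]
    linarith [ha v, hb' v]
  obtain ⟨v₀, hv₀⟩ := hcont.exists_forall_le hcoercive
  refine ⟨v₀, hv₀, fun u hu => ?_⟩
  by_contra hne
  have hpar : ∀ B : E →ₗ[ℝ] E →ₗ[ℝ] ℝ,
      B ((1 / 2 : ℝ) • (u + v₀)) ((1 / 2 : ℝ) • (u + v₀))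
        = (B u u + B v₀ v₀) / 2 - B (u - v₀) (u - v₀) / 4 := fun B => by
    simp only [map_add, map_sub, map_smul, LinearMap.add_apply, LinearMap.sub_apply,
      LinearMap.smul_apply, smul_eq_mul]
    ring
  have hnorm : ‖(1 / 2 : ℝ) • (u + v₀)‖ ^ 4 ≤ (‖u‖ ^ 4 + ‖v₀‖ ^ 4) / 2 := by
    have h : ‖(1 / 2 : ℝ) • (u + v₀)‖ ≤ (1 / 2) * ‖u‖ + (1 / 2) * ‖v₀‖ := by
      rw [norm_smul, Real.norm_of_nonneg (by norm_num)]
      linarith [norm_add_le u v₀]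
    have hconv := (convexOn_pow 4).2 (norm_nonneg u) (norm_nonneg v₀)
      (by norm_num : (0 : ℝ) ≤ 1 / 2) (by norm_num : (0 : ℝ) ≤ 1 / 2) (by norm_num)
    simp only [smul_eq_mul] at hconv
    linarith [pow_le_pow_left₀ (norm_nonneg _) h 4]
  have hmid := hu ((1 / 2 : ℝ) • (u + v₀))
  have hmid' := hv₀ ((1 / 2 : ℝ) • (u + v₀))
  rw [hpar a, hpar b] at hmid hmid'
  have hlin : l ((1 / 2 : ℝ) • (u + v₀)) = (l u + l v₀) / 2 := by
    simp only [map_add, map_smul, smul_eq_mul]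
    ring
  linarith [ha (u - v₀), hb _ (sub_ne_zero.2 hne), mul_le_mul_of_nonneg_left hnorm hc.le]

namespace MeasureTheory

variable {α : Type*} [MeasurableSpace α] {μ : Measure α}

theorem Lp.integral_pow_four_eq_norm_pow (f : Lp ℝ 4 μ) : ∫ x, f x ^ 4 ∂μ = ‖f‖ ^ 4 := by
  have h := (Lp.memLp f).eLpNorm_eq_integral_rpow_norm (by norm_num) (by norm_num)
  have h4 : (4 : ENNReal).toReal = ((4 : ℕ) : ℝ) := by norm_num
  have hint : ∫ x, ‖f x‖ ^ (4 : ENNReal).toReal ∂μ = ∫ x, f x ^ 4 ∂μ := by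
    refine integral_congr_ae (.of_forall fun x => ?_)
    simp only [h4, Real.rpow_natCast, Real.norm_eq_abs]
    exact Even.pow_abs (by decide) _
  have hnonneg : 0 ≤ ∫ x, f x ^ 4 ∂μ := integral_nonneg fun x => by positivity
  rw [hint, h4] at h
  rw [Lp.norm_def, h, ENNReal.toReal_ofReal (by positivity),
    Real.rpow_inv_natCast_pow hnonneg (by norm_num)]

theorem Lp.integrable_pow_four (f : Lp ℝ 4 μ) : Integrable (fun x => f x ^ 4) μ := by
  refine ((Lp.memLp f).integrable_norm_pow (p := 4) (by norm_num)).congr (.of_forall fun x => ?_)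
  simp only [Real.norm_eq_abs]
  exact Even.pow_abs (by decide) _

variable [IsFiniteMeasure μ]

theorem Lp.integrable_mul_of_four (f g : Lp ℝ 4 μ) : Integrable (fun x => f x * g x) μ := by
  have h : (2 : ENNReal) ≤ 4 := by norm_num
  exact ((Lp.memLp f).mono_exponent h).integrable_mul ((Lp.memLp g).mono_exponent h)

/-- The `L²` pairing on `L⁴` of a finite measure. -/
noncomputable def Lp.mulIntegral (μ : Measure α) [IsFiniteMeasure μ] :
    Lp ℝ 4 μ →ₗ[ℝ] Lp ℝ 4 μ →ₗ[ℝ] ℝ :=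
  LinearMap.mk₂ ℝ (fun f g => ∫ x, f x * g x ∂μ)
    (fun f₁ f₂ g => by
      rw [← integral_add (integrable_mul_of_four f₁ g) (integrable_mul_of_four f₂ g)]
      refine integral_congr_ae ?_
      filter_upwards [Lp.coeFn_add f₁ f₂] with x hx
      rw [hx, Pi.add_apply, add_mul])
    (fun r f g => by
      rw [smul_eq_mul, ← integral_const_mul]
      refine integral_congr_ae ?_
      filter_upwards [Lp.coeFn_smul r f] with x hx
      rw [hx, Pi.smul_apply, smul_eq_mul, mul_assoc])
    (fun f g₁ g₂ => by
      rw [← integral_add (integrable_mul_of_four f g₁) (integrable_mul_of_four f g₂)]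
      refine integral_congr_ae ?_
      filter_upwards [Lp.coeFn_add g₁ g₂] with x hx
      rw [hx, Pi.add_apply, mul_add])
    (fun r f g => by
      rw [smul_eq_mul, ← integral_const_mul]
      refine integral_congr_ae ?_
      filter_upwards [Lp.coeFn_smul r g] with x hx
      rw [hx, Pi.smul_apply, smul_eq_mul, mul_left_comm])

theorem Lp.mulIntegral_apply (f g : Lp ℝ 4 μ) : mulIntegral μ f g = ∫ x, f x * g x ∂μ := rfl

theorem Lp.mulIntegral_self_pos {f : Lp ℝ 4 μ} (hf : f ≠ 0) : 0 < mulIntegral μ f f := by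
  have hnonneg : 0 ≤ fun x => f x * f x := fun x => mul_self_nonneg _
  rw [mulIntegral_apply]
  refine (integral_nonneg hnonneg).lt_of_ne' fun h => hf ?_
  rw [integral_eq_zero_iff_of_nonneg hnonneg (integrable_mul_of_four f f)] at h
  rw [Lp.eq_zero_iff_ae_eq_zero]
  filter_upwards [h] with x hx
  exact mul_self_eq_zero.1 hx

end MeasureTheory

/-- Unconditional well-posedness of one time step of the IP-DG scheme with the
convex-splitting treatment `f^{m+1} = (u^{m+1})³ − u^m`: the functional `H` has
a unique minimizer over the finite-dimensional discrete space `V`. -/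
theorem convex_splitting_step_wellposed
    {α : Type*} [MeasurableSpace α] (μ : Measure α) [IsFiniteMeasure μ]
    (V : Submodule ℝ (Lp ℝ 4 μ)) [FiniteDimensional ℝ V]
    (a : V →ₗ[ℝ] V →ₗ[ℝ] ℝ)
    (ha_symm : ∀ v w : V, a v w = a w v)
    (ha_nonneg : ∀ v : V, 0 ≤ a v v)
    (w : V) (k ε : ℝ) (hk : 0 < k) (hε : 0 < ε) :
    ∃! v₀ : V,
      ∀ v : V,
        (k / 2) * a v₀ v₀
            + (k / ε ^ 2) * ∫ x, (1 / 4) * (((v₀ : Lp ℝ 4 μ) : α → ℝ) x ^ 4 + 1) ∂μ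
            + (1 / 2) * ∫ x, ((v₀ : Lp ℝ 4 μ) : α → ℝ) x ^ 2 ∂μ
            - (k / ε ^ 2 + 1) * ∫ x, ((w : Lp ℝ 4 μ) : α → ℝ) x * ((v₀ : Lp ℝ 4 μ) : α → ℝ) x ∂μ
        ≤ (k / 2) * a v v
            + (k / ε ^ 2) * ∫ x, (1 / 4) * (((v : Lp ℝ 4 μ) : α → ℝ) x ^ 4 + 1) ∂μ
            + (1 / 2) * ∫ x, ((v : Lp ℝ 4 μ) : α → ℝ) x ^ 2 ∂μ
            - (k / ε ^ 2 + 1) * ∫ x, ((w : Lp ℝ 4 μ) : α → ℝ) x * ((v : Lp ℝ 4 μ) : α → ℝ) x ∂μ := by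
  have : Fact ((1 : ENNReal) ≤ 4) := ⟨by norm_num⟩
  let b : V →ₗ[ℝ] V →ₗ[ℝ] ℝ := (Lp.mulIntegral μ).compl₁₂ V.subtype V.subtype
  have hb : ∀ u v : V, b u v = ∫ x, (u : Lp ℝ 4 μ) x * (v : Lp ℝ 4 μ) x ∂μ := fun _ _ => rfl
  have hpot : ∀ v : V, ∫ x, (1 / 4) * ((v : Lp ℝ 4 μ) x ^ 4 + 1) ∂μ
      = (1 / 4) * ‖v‖ ^ 4 + (1 / 4) * μ.real Set.univ := fun v => by
    rw [integral_const_mul, integral_add (Lp.integrable_pow_four _) (integrable_const 1),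
      Lp.integral_pow_four_eq_norm_pow, integral_const, smul_eq_mul, mul_one, mul_add,
      Submodule.coe_norm]
  have hsq : ∀ v : V, ∫ x, (v : Lp ℝ 4 μ) x ^ 2 ∂μ = b v v := fun v => by
    simp only [hb, sq]
  have hmin := existsUnique_minimizer_quadratic_add_norm_pow_four
    ((k / 2) • a) ((1 / 2 : ℝ) • b)
    (fun v => mul_nonneg (by positivity) (ha_nonneg v))
    (fun v hv => mul_pos (by norm_num)
      (Lp.mulIntegral_self_pos fun h => hv (Subtype.ext h)))
    ((k / ε ^ 2 + 1) • b w) (c := k / ε ^ 2 * (1 / 4)) (by positivity)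
  refine (existsUnique_congr fun v₀ => forall_congr' fun v => ?_).1 hmin
  simp only [hpot, hsq, ← hb, LinearMap.smul_apply, smul_eq_mul]
  constructor <;> intro h <;> linarith
end
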